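/- For every k-bounded partition λ and every k-rectangle □, the k-conjugate distributes over the union: (λ ∪ □)^{ω_k} = λ^{ω_k} ∪ □^{ω_k}. -/

import Mathlib

/-- A partition: a weakly decreasing list of positive integers. -/
def IsPartition (l : List ℕ) : Prop :=
  l.Pairwise (· ≥ ·) ∧ ∀ x ∈ l, 0 < x

/-- The `i`-th part (0-indexed), with parts beyond the length equal to 0. -/
def part (l : List ℕ) (i : ℕ) : ℕ := l.getD i 0

/-- Diagram containment `l ⊆ m`: every part of `l` is at most the corresponding part of `m`. -/
def SubDiag (l m : List ℕ) : Prop := ∀ i, part l i ≤ part m i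

/-- A `k`-bounded partition: a partition whose first part is at most `k`. -/
def KBounded (k : ℕ) (l : List ℕ) : Prop := IsPartition l ∧ part l 0 ≤ k

/-- Hook length of the square `(i,j)` (0-indexed) with respect to the skew diagram
`outer/inner`: the number of cells `(i,j')` of the skew diagram with `j' ≥ j` plus the
number of cells `(i',j)` of the skew diagram with `i' > i`. -/
def hookLen (outer inner : List ℕ) (i j : ℕ) : ℕ :=
  ((Finset.range (part outer i)).filter (fun j' => j ≤ j' ∧ part inner i ≤ j')).card +
  ((Finset.range outer.length).filter
    (fun i' => i < i' ∧ part inner i' ≤ j ∧ j < part outer i')).card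

/-- `(outer, inner)` is the `k`-skew diagram of the `k`-bounded partition `l`:
row `i` of `outer/inner` has `l i` cells, every cell of `outer/inner` has hook length
at most `k`, and every square of the inner shape has hook length exceeding `k`. -/
def IsKSkew (k : ℕ) (l outer inner : List ℕ) : Prop :=
  IsPartition outer ∧ IsPartition inner ∧ SubDiag inner outer ∧
  (∀ i, part outer i - part inner i = part l i) ∧
  (∀ i j, part inner i ≤ j → j < part outer i → hookLen outer inner i j ≤ k) ∧
  (∀ i j, j < part inner i → k < hookLen outer inner i j)

/-- Length of column `j` of the skew diagram `outer/inner`. -/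
def colLen (outer inner : List ℕ) (j : ℕ) : ℕ :=
  ((Finset.range outer.length).filter
    (fun i => part inner i ≤ j ∧ j < part outer i)).card

/-- The list of column lengths of the skew diagram `outer/inner`. -/
def skewCols (outer inner : List ℕ) : List ℕ :=
  ((List.range (part outer 0)).map (colLen outer inner)).filter (fun x => decide (x ≠ 0))

/-- The `k`-conjugate of `l`: the partition whose parts are the column lengths of the
(unique) `k`-skew diagram of `l`. -/
noncomputable def kConj (k : ℕ) (l : List ℕ) : List ℕ :=
  haveI := Classical.dec (∃ p : List ℕ × List ℕ, IsKSkew k l p.1 p.2)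
  if h : ∃ p : List ℕ × List ℕ, IsKSkew k l p.1 p.2 then
    skewCols h.choose.1 h.choose.2
  else []

/-- The covering relation of the `k`-Young order on `k`-bounded partitions. -/
def KCover (k : ℕ) (l m : List ℕ) : Prop :=
  KBounded k l ∧ KBounded k m ∧ SubDiag l m ∧
  SubDiag (kConj k l) (kConj k m) ∧ m.sum = l.sum + 1

/-- The `k`-Young order: reflexive-transitive closure of the covering relation. -/
def KLe (k : ℕ) : List ℕ → List ℕ → Prop := Relation.ReflTransGen (KCover k)

/-- The weakly decreasing rearrangement of the combined parts of two partitions. -/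
def punion (l r : List ℕ) : List ℕ := (l ++ r).mergeSort (fun a b => decide (a ≥ b))

/-- The ordinary conjugate of a partition: the list of column lengths of its diagram. -/
def conj (l : List ℕ) : List ℕ :=
  (List.range (part l 0)).map (fun j => (l.filter (fun x => decide (j < x))).length)

/-- Column heights of a `k`-skew diagram after adding a new bottom row of size `a`, given the
column heights `c` of the rows above it: column `j` gains a cell when its hook length in the new
row stays at most `k` and it lies within `a` columns of the first such column. -/
def addRow (k a : ℕ) (c : ℕ → ℕ) : ℕ → ℕ := fun j =>
  c j + if a + c j ≤ k ∧ (j < a ∨ k < a + c (j - a)) then 1 else 0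

/-- Column heights of the `k`-skew diagram of `l`, built row by row from the top. -/
def colHeights (k : ℕ) (l : List ℕ) : ℕ → ℕ := l.foldr (addRow k) 0

/-- For a weakly decreasing `c`, the weakly decreasing rearrangement of `c` together with `w`
copies of `h`. -/
def insertCols (w h : ℕ) (c : ℕ → ℕ) : ℕ → ℕ := fun j =>
  max (c j) (if j < w then h else min h (c (j - w)))

theorem addRow_antitone {k a : ℕ} {c : ℕ → ℕ} (hc : Antitone c) : Antitone (addRow k a c) := by
  intro i j hij
  have h1 := hc hij
  have h2 : c (j - a) ≤ c (i - a) := hc (by omega)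
  unfold addRow
  split_ifs <;> omega

theorem foldr_addRow_antitone {k : ℕ} {c : ℕ → ℕ} (hc : Antitone c) (l : List ℕ) :
    Antitone (l.foldr (addRow k) c) := by
  induction l with
  | nil => exact hc
  | cons a l ih => exact addRow_antitone ih

theorem colHeights_antitone (k : ℕ) (l : List ℕ) : Antitone (colHeights k l) :=
  foldr_addRow_antitone antitone_const l

theorem colHeights_eventually_zero {k : ℕ} {l : List ℕ} (hl : ∀ x ∈ l, x ≤ k) :
    ∃ N, ∀ j, N ≤ j → colHeights k l j = 0 := by
  induction l with
  | nil => exact ⟨0, fun _ _ => rfl⟩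
  | cons a l ih =>
    obtain ⟨N, hN⟩ := ih fun x hx => hl x (List.mem_cons_of_mem _ hx)
    have ha := hl a List.mem_cons_self
    refine ⟨N + a, fun j hj => ?_⟩
    have h1 := hN j (by omega)
    have h2 := hN (j - a) (by omega)
    change addRow k a (colHeights k l) j = 0
    unfold addRow
    split_ifs <;> omega

theorem addRow_eq_of_first {k a m : ℕ} {c : ℕ → ℕ} (hc : Antitone c)
    (hlt : ∀ j < m, k < a + c j) (hm : a + c m ≤ k) (j : ℕ) :
    addRow k a c j = c j + if m ≤ j ∧ j < m + a then 1 else 0 := by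
  have key : ∀ i, i < m ↔ k < a + c i := fun i => ⟨hlt i, fun h => by
    by_contra! hi
    have := hc hi
    omega⟩
  have h1 := key j
  have h2 := key (j - a)
  unfold addRow
  congr 1
  refine if_congr ?_ rfl rfl
  omega

theorem addRow_insertCols {k ℓ a : ℕ} {c : ℕ → ℕ} (hc : Antitone c) (hℓa : ℓ ≤ a) (hak : a ≤ k) :
    addRow k a (insertCols ℓ (k - ℓ + 1) c) = insertCols ℓ (k - ℓ + 1) (addRow k a c) := by
  funext j
  have h1 : c j ≤ c (j - ℓ) := hc (by omega)
  have h2 : c (j - ℓ) ≤ c (j - a) := hc (by omega)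
  have h3 : c (j - a) ≤ c (j - a - ℓ) := hc (by omega)
  have h4 : j - ℓ - a = j - a - ℓ := by omega
  unfold addRow insertCols
  simp only [h4]
  split_ifs <;> omega

theorem foldr_addRow_insertCols {k ℓ : ℕ} {c : ℕ → ℕ} (hc : Antitone c) {l : List ℕ}
    (hl : ∀ x ∈ l, ℓ ≤ x ∧ x ≤ k) :
    l.foldr (addRow k) (insertCols ℓ (k - ℓ + 1) c) =
      insertCols ℓ (k - ℓ + 1) (l.foldr (addRow k) c) := by
  induction l with
  | nil => rfl
  | cons a l ih =>
    have ha := hl a List.mem_cons_self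
    rw [List.foldr_cons, ih fun x hx => hl x (List.mem_cons_of_mem _ hx),
      addRow_insertCols (foldr_addRow_antitone hc l) ha.1 ha.2, List.foldr_cons]

theorem colHeights_add_eq_zero {k ℓ : ℕ} (hℓk : ℓ ≤ k) {l : List ℕ} (hl : ∀ x ∈ l, x ≤ ℓ) (j : ℕ)
    (hj : colHeights k l j < k - ℓ + 1) : colHeights k l (j + ℓ) = 0 := by
  induction l generalizing j with
  | nil => rfl
  | cons a l ih =>
    have ha := hl a List.mem_cons_self
    change addRow k a (colHeights k l) j < _ at hj
    change addRow k a (colHeights k l) (j + ℓ) = 0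
    unfold addRow at hj ⊢
    have h0 := ih (fun x hx => hl x (List.mem_cons_of_mem _ hx)) j (by omega)
    have h1 : colHeights k l (j + ℓ - a) ≤ colHeights k l j :=
      colHeights_antitone k l (by omega)
    split_ifs <;> omega

theorem foldr_replicate_addRow {k ℓ : ℕ} (hℓk : ℓ ≤ k) {c : ℕ → ℕ} (hc : Antitone c)
    (h0 : ∀ j, c j < k - ℓ + 1 → c (j + ℓ) = 0) {t : ℕ} (ht : t ≤ k - ℓ + 1) :
    (List.replicate t ℓ).foldr (addRow k) c = fun j =>
      if k - ℓ + 1 ≤ c j then c j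
      else if j < ℓ ∨ k - ℓ + 1 ≤ c (j - ℓ) then min (k - ℓ + 1) (c j + t)
      else c (j - ℓ) + t - (k - ℓ + 1) := by
  induction t with
  | zero =>
    funext j
    have h2 := h0 (j - ℓ)
    rcases lt_or_ge j ℓ with hj | hj
    · simp [hj]
      omega
    · rw [Nat.sub_add_cancel hj] at h2
      simp only [List.replicate_zero, List.foldr_nil]
      split_ifs <;> omega
  | succ t ih =>
    rw [List.replicate_succ, List.foldr_cons, ih (by omega)]
    funext j
    have h1 : c j ≤ c (j - ℓ) := hc (by omega)
    have h2 : c (j - ℓ) ≤ c (j - ℓ - ℓ) := hc (by omega)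
    have h3 := h0 (j - ℓ)
    have h4 := h0 (j - ℓ - ℓ)
    unfold addRow
    dsimp only
    rcases lt_or_ge j ℓ with hj | hj
    · simp only [hj, true_or, if_true, and_true]
      split_ifs <;> omega
    · rw [Nat.sub_add_cancel hj] at h3
      rcases lt_or_ge (j - ℓ) ℓ with hj' | hj'
      · simp only [hj.not_gt, hj', true_or, if_true, false_or]
        split_ifs <;> omega
      · rw [Nat.sub_add_cancel hj'] at h4
        simp only [hj.not_gt, hj'.not_gt, false_or]
        split_ifs <;> omega

theorem foldr_kRectangle {k ℓ : ℕ} (hℓk : ℓ ≤ k) {c : ℕ → ℕ} (hc : Antitone c)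
    (h0 : ∀ j, c j < k - ℓ + 1 → c (j + ℓ) = 0) :
    (List.replicate (k - ℓ + 1) ℓ).foldr (addRow k) c = insertCols ℓ (k - ℓ + 1) c := by
  rw [foldr_replicate_addRow hℓk hc h0 le_rfl]
  funext j
  have h1 : c j ≤ c (j - ℓ) := hc (by omega)
  unfold insertCols
  split_ifs <;> omega

@[simp] theorem part_nil (i : ℕ) : part [] i = 0 := by simp [part]

@[simp] theorem part_cons_zero (a : ℕ) (l : List ℕ) : part (a :: l) 0 = a := rfl

@[simp] theorem part_cons_succ (a : ℕ) (l : List ℕ) (i : ℕ) :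
    part (a :: l) (i + 1) = part l i := by simp [part]

theorem part_tail (l : List ℕ) (i : ℕ) : part l.tail i = part l (i + 1) := by
  cases l <;> simp

theorem part_append (l m : List ℕ) (i : ℕ) :
    part (l ++ m) i = if i < l.length then part l i else part m (i - l.length) := by
  unfold part
  split_ifs with h
  · exact List.getD_append _ _ _ _ h
  · exact List.getD_append_right _ _ _ _ (by omega)

theorem part_replicate (n a i : ℕ) : part (List.replicate n a) i = if i < n then a else 0 := by
  unfold part
  split_ifs with h
  · simp [h]
  · exact List.getD_eq_default _ _ (by simpa using h)

theorem part_mem {l : List ℕ} {i : ℕ} (h : i < l.length) : part l i ∈ l := by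
  rw [part, List.getD_eq_getElem _ _ h]
  exact List.getElem_mem h

theorem part_eq_zero {l : List ℕ} {i : ℕ} (h : l.length ≤ i) : part l i = 0 :=
  List.getD_eq_default _ _ h

theorem isPartition_nil : IsPartition [] := ⟨List.Pairwise.nil, by simp⟩

theorem isPartition_cons {a : ℕ} {l : List ℕ} :
    IsPartition (a :: l) ↔ 0 < a ∧ part l 0 ≤ a ∧ IsPartition l := by
  unfold IsPartition
  rw [List.pairwise_cons]
  constructor
  · rintro ⟨⟨h1, h2⟩, h3⟩
    refine ⟨h3 a List.mem_cons_self, ?_, h2, fun x hx => h3 x (List.mem_cons_of_mem _ hx)⟩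
    cases l with
    | nil => simp
    | cons b l => exact h1 b List.mem_cons_self
  · rintro ⟨h1, h2, h3, h4⟩
    refine ⟨⟨fun x hx => ?_, h3⟩, fun x hx => ?_⟩
    · cases l with
      | nil => simp at hx
      | cons b l =>
        rcases List.mem_cons.1 hx with rfl | hx
        · exact h2
        · exact ((List.pairwise_cons.1 h3).1 x hx).trans h2
    · rcases List.mem_cons.1 hx with rfl | hx
      · exact h1
      · exact h4 x hx

theorem IsPartition.tail {l : List ℕ} (h : IsPartition l) : IsPartition l.tail := by
  cases l with
  | nil => exact h
  | cons a l => exact (isPartition_cons.1 h).2.2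

theorem IsPartition.ext {l m : List ℕ} (hl : IsPartition l) (hm : IsPartition m)
    (h : ∀ i, part l i = part m i) : l = m := by
  induction l generalizing m with
  | nil =>
    cases m with
    | nil => rfl
    | cons b m =>
      have := h 0
      have := (isPartition_cons.1 hm).1
      simp at *
      omega
  | cons a l ih =>
    cases m with
    | nil =>
      have := h 0
      have := (isPartition_cons.1 hl).1
      simp at *
      omega
    | cons b m =>
      have h0 : a = b := h 0
      rw [h0, ih (isPartition_cons.1 hl).2.2 (isPartition_cons.1 hm).2.2
        fun i => by simpa using h (i + 1)]

theorem colLen_eq_sum (O I : List ℕ) (j : ℕ) : colLen O I j =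
    ∑ i ∈ Finset.range O.length, if part I i ≤ j ∧ j < part O i then 1 else 0 :=
  Finset.card_filter _ _

theorem colLen_cons (o : ℕ) (O I : List ℕ) (j : ℕ) : colLen (o :: O) I j =
    colLen O I.tail j + if part I 0 ≤ j ∧ j < o then 1 else 0 := by
  rw [colLen_eq_sum, List.length_cons, Finset.sum_range_succ', colLen_eq_sum]
  simp only [part_tail]
  rfl

theorem hookLen_eq_sum (O I : List ℕ) (i j : ℕ) : hookLen O I i j =
    (part O i - max j (part I i)) +
      ∑ i' ∈ Finset.range O.length,
        if i < i' ∧ part I i' ≤ j ∧ j < part O i' then 1 else 0 := by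
  unfold hookLen
  rw [Finset.card_filter _ (Finset.range O.length)]
  congr 1
  rw [← Nat.card_Ico]
  congr 1
  ext x
  simp only [Finset.mem_filter, Finset.mem_range, Finset.mem_Ico, max_le_iff]
  tauto

theorem hookLen_cons_zero (o : ℕ) (O I : List ℕ) (j : ℕ) : hookLen (o :: O) I 0 j =
    (o - max j (part I 0)) + colLen O I.tail j := by
  rw [hookLen_eq_sum, List.length_cons, Finset.sum_range_succ', colLen_eq_sum]
  simp [-Finset.sum_boole, part_tail]

theorem hookLen_cons_succ (o : ℕ) (O I : List ℕ) (i j : ℕ) : hookLen (o :: O) I (i + 1) j =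
    hookLen O I.tail i j := by
  rw [hookLen_eq_sum, List.length_cons, Finset.sum_range_succ', hookLen_eq_sum]
  simp [-Finset.sum_boole, part_tail]

theorem IsKSkew.eq_nil {k : ℕ} {O I : List ℕ} (h : IsKSkew k [] O I) : O = [] := by
  by_contra hO
  obtain ⟨hO', -, -, h1, -, h3⟩ := h
  have hlen := List.length_pos_iff.2 hO
  have hpos := hO'.2 _ (part_mem (show O.length - 1 < O.length by omega))
  have h1' := h1 (O.length - 1)
  rw [part_nil] at h1'
  have h3' := h3 (O.length - 1) (part I (O.length - 1) - 1) (by omega)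
  rw [hookLen_eq_sum, Finset.sum_eq_zero] at h3'
  · omega
  · intro i hi
    rw [Finset.mem_range] at hi
    rw [if_neg (by omega)]

theorem IsKSkew.tail {k a o : ℕ} {l O I : List ℕ} (h : IsKSkew k (a :: l) (o :: O) I) :
    IsKSkew k l O I.tail := by
  obtain ⟨hO, hI, hs, h1, h2, h3⟩ := h
  refine ⟨hO.tail, hI.tail, fun i => ?_, fun i => ?_, fun i j => ?_, fun i j => ?_⟩
  · simpa [part_tail] using hs (i + 1)
  · simpa [part_tail] using h1 (i + 1)
  · simpa [part_tail, hookLen_cons_succ] using h2 (i + 1) j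
  · simpa [part_tail, hookLen_cons_succ] using h3 (i + 1) j

theorem IsKSkew.colLen_eq {k : ℕ} {l O I : List ℕ} (hl : ∀ x ∈ l, 0 < x)
    (h : IsKSkew k l O I) (j : ℕ) : colLen O I j = colHeights k l j := by
  induction l generalizing O I j with
  | nil =>
    rw [h.eq_nil]
    rfl
  | cons a l ih =>
    have ha := hl a List.mem_cons_self
    have h0 := h.2.2.2.1 0
    cases O with
    | nil => simp at h0; omega
    | cons o O =>
      have ih' := ih (fun x hx => hl x (List.mem_cons_of_mem _ hx)) h.tail
      obtain ⟨-, -, hs, -, h2, h3⟩ := h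
      simp only [part_cons_zero] at h0
      have h2' := h2 0 (part I 0) le_rfl (by simp; omega)
      rw [hookLen_cons_zero, ih', max_self, h0] at h2'
      change _ = addRow k a (colHeights k l) j
      rw [colLen_cons, ih', addRow_eq_of_first (colHeights_antitone k l) _ h2',
        show part I 0 + a = o by omega]
      intro j hj
      have h3' := h3 0 j hj
      rwa [hookLen_cons_zero, ih', max_eq_right hj.le, h0] at h3'

theorem part_zero_le_of_isKSkew {k a m : ℕ} {l O I : List ℕ} (h : IsKSkew k l O I)
    (hal : part l 0 ≤ a) (hm : a + colLen O I m ≤ k) : part I 0 ≤ m := by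
  obtain ⟨-, -, hs, h1, -, h3⟩ := h
  by_contra! hlt
  have h3' := h3 0 m hlt
  have h1' := h1 0
  have hs' := hs 0
  cases O with
  | nil => simp at hs'; omega
  | cons o O =>
    rw [hookLen_cons_zero, max_eq_right hlt.le] at h3'
    rw [colLen_cons] at hm
    simp only [part_cons_zero] at h1'
    omega

theorem IsKSkew.cons {k a m : ℕ} {l O I : List ℕ} (h : IsKSkew k l O I) (ha : 0 < a)
    (hal : part l 0 ≤ a) (hanti : Antitone (colLen O I)) (hlt : ∀ j < m, k < a + colLen O I j)
    (hm : a + colLen O I m ≤ k) :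
    IsKSkew k (a :: l) ((m + a) :: O) (if m = 0 then [] else m :: I) := by
  have hIm := part_zero_le_of_isKSkew h hal hm
  obtain ⟨hO, hI, hs, h1, h2, h3⟩ := h
  have hI0 : m = 0 → I = [] := by
    rintro rfl
    cases I with
    | nil => rfl
    | cons b I =>
      have := (isPartition_cons.1 hI).1
      simp at hIm
      omega
  have hpart : ∀ i, part (if m = 0 then [] else m :: I) i = part (m :: I) i := by
    intro i
    split_ifs with h0
    · rw [hI0 h0, h0]
      cases i <;> simp
    · rfl
  have htail : (if m = 0 then [] else m :: I).tail = I := by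
    split_ifs with h0
    · rw [hI0 h0]; rfl
    · rfl
  have h10 := h1 0
  refine ⟨isPartition_cons.2 ⟨by omega, by omega, hO⟩, ?_, fun i => ?_, fun i => ?_,
    fun i j => ?_, fun i j => ?_⟩
  · split_ifs with h0
    · exact isPartition_nil
    · exact isPartition_cons.2 ⟨by omega, hIm, hI⟩
  · rw [hpart]
    cases i with
    | zero => simp
    | succ i => simpa using hs i
  · rw [hpart]
    cases i with
    | zero => simp
    | succ i => simpa using h1 i
  · rw [hpart]
    cases i with
    | zero =>
      intro hj _
      rw [hookLen_cons_zero, htail, hpart]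
      have := hanti hj
      simp only [part_cons_zero] at *
      omega
    | succ i => simpa [hookLen_cons_succ, htail] using h2 i j
  · rw [hpart]
    cases i with
    | zero =>
      intro hj
      rw [hookLen_cons_zero, htail, hpart]
      have := hlt j hj
      simp only [part_cons_zero] at *
      omega
    | succ i => simpa [hookLen_cons_succ, htail] using h3 i j

theorem exists_isKSkew {k : ℕ} {l : List ℕ} (hl : IsPartition l) (hk : ∀ x ∈ l, x ≤ k) :
    ∃ p : List ℕ × List ℕ, IsKSkew k l p.1 p.2 := by
  induction l with
  | nil =>
    refine ⟨([], []), isPartition_nil, isPartition_nil, ?_, ?_, ?_, ?_⟩ <;> simp [SubDiag]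
  | cons a l ih =>
    have hk' : ∀ x ∈ l, x ≤ k := fun x hx => hk x (List.mem_cons_of_mem _ hx)
    obtain ⟨ha, hal, hl'⟩ := isPartition_cons.1 hl
    obtain ⟨⟨O, I⟩, h⟩ := ih hl' hk'
    have hcol : colLen O I = colHeights k l := funext (h.colLen_eq hl'.2)
    have hex : ∃ m, a + colLen O I m ≤ k := by
      obtain ⟨N, hN⟩ := colHeights_eventually_zero hk'
      refine ⟨N, ?_⟩
      rw [hcol, hN N le_rfl]
      exact hk a List.mem_cons_self
    classical
    exact ⟨(_, _), h.cons ha hal (hcol ▸ colHeights_antitone k l)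
      (fun j hj => not_le.1 (Nat.find_min hex hj)) (Nat.find_spec hex)⟩

/-- The nonzero values of a weakly decreasing function form a partition. -/
theorem filter_map_range_of_antitone {c : ℕ → ℕ} (hc : Antitone c) {n : ℕ}
    (h0 : ∀ j, n ≤ j → c j = 0) :
    IsPartition (((List.range n).map c).filter fun x => decide (x ≠ 0)) ∧
      ∀ j, part (((List.range n).map c).filter fun x => decide (x ≠ 0)) j = c j := by
  induction n generalizing c with
  | zero => exact ⟨isPartition_nil, fun j => by simp [h0 j]⟩
  | succ n ih =>
    obtain ⟨h1, h2⟩ := ih (c := fun j => c (j + 1)) (fun i j hij => hc (by omega))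
      (fun j hj => h0 _ (by omega))
    have hmap : (List.range (n + 1)).map c = c 0 :: (List.range n).map fun j => c (j + 1) := by
      rw [List.range_succ_eq_map, List.map_cons, List.map_map]
      rfl
    rw [hmap]
    by_cases hz : c 0 = 0
    · have hall : ∀ j, c j = 0 := fun j => by
        have := hc (Nat.zero_le j)
        omega
      have hnil : (c 0 :: (List.range n).map fun j => c (j + 1)).filter
          (fun x => decide (x ≠ 0)) = [] := by
        simp [hall]
      rw [hnil]
      exact ⟨isPartition_nil, fun j => by simp [hall]⟩
    · rw [List.filter_cons_of_pos (by simpa using hz)]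
      refine ⟨isPartition_cons.2 ⟨by omega, ?_, h1⟩, fun j => ?_⟩
      · rw [h2]
        exact hc (by omega)
      · cases j with
        | zero => rfl
        | succ j => rw [part_cons_succ, h2]

theorem IsPartition.part_antitone {l : List ℕ} (hl : IsPartition l) : Antitone (part l) := by
  refine antitone_nat_of_succ_le fun i => ?_
  induction l generalizing i with
  | nil => simp
  | cons a l ih =>
    obtain ⟨-, h, h'⟩ := isPartition_cons.1 hl
    cases i with
    | zero => simpa using h
    | succ i => simpa using ih h' i

theorem kConj_spec {k : ℕ} {l : List ℕ} (hl : IsPartition l) (hk : ∀ x ∈ l, x ≤ k) :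
    IsPartition (kConj k l) ∧ ∀ j, part (kConj k l) j = colHeights k l j := by
  have hex := exists_isKSkew hl hk
  have hs := hex.choose_spec
  unfold kConj
  rw [dif_pos hex]
  have hcol : colLen hex.choose.1 hex.choose.2 = colHeights k l := funext (hs.colLen_eq hl.2)
  unfold skewCols
  rw [hcol]
  refine filter_map_range_of_antitone (colHeights_antitone k l) fun j hj => ?_
  rw [← hcol, colLen_eq_sum]
  refine Finset.sum_eq_zero fun i _ => if_neg ?_
  have := hs.1.part_antitone (Nat.zero_le i)
  omega

theorem pairwise_filter_append {l : List ℕ} (hl : l.Pairwise (· ≥ ·)) (n a : ℕ) :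
    (l.filter (fun x => decide (a ≤ x)) ++
      (List.replicate n a ++ l.filter (fun x => !decide (a ≤ x)))).Pairwise (· ≥ ·) := by
  simp only [List.pairwise_append, List.mem_append, List.mem_replicate, List.mem_filter]
  refine ⟨hl.filter _, ⟨?_, hl.filter _, ?_⟩, ?_⟩
  · exact List.pairwise_replicate.2 (Or.inr le_rfl)
  · rintro x ⟨-, rfl⟩ y ⟨-, hy⟩
    simp at hy
    omega
  · rintro x ⟨-, hx⟩ y (⟨-, rfl⟩ | ⟨-, hy⟩)
    · simpa using hx
    · simp at hx hy
      omega

theorem filter_append_filter_not {l : List ℕ} (hl : l.Pairwise (· ≥ ·)) (a : ℕ) :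
    l.filter (fun x => decide (a ≤ x)) ++ l.filter (fun x => !decide (a ≤ x)) = l :=
  (List.filter_append_perm (fun x => decide (a ≤ x)) l).eq_of_pairwise
    (fun _ _ _ _ h1 h2 => le_antisymm h2 h1) (by simpa using pairwise_filter_append hl 0 a) hl

theorem punion_replicate {l : List ℕ} (hl : l.Pairwise (· ≥ ·)) (n a : ℕ) :
    punion l (List.replicate n a) = l.filter (fun x => decide (a ≤ x)) ++
      (List.replicate n a ++ l.filter (fun x => !decide (a ≤ x))) := by
  refine List.Perm.eq_of_pairwise (le := (· ≥ ·)) (fun _ _ _ _ h1 h2 => le_antisymm h2 h1)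
    ?_ (pairwise_filter_append hl n a) ?_
  · have := List.pairwise_mergeSort (le := fun a b : ℕ => decide (a ≥ b))
      (fun a b c h1 h2 => by simp at *; omega) (fun a b => by simp; omega)
      (l ++ List.replicate n a)
    simpa [punion] using this
  · refine (List.mergeSort_perm _ _).trans ?_
    refine ((List.filter_append_perm (fun x => decide (a ≤ x)) l).symm.append_right _).trans ?_
    rw [List.append_assoc]
    exact List.perm_append_comm.append_left _

theorem isPartition_punion_replicate {l : List ℕ} (hl : IsPartition l) (n : ℕ) {a : ℕ}
    (ha : 0 < a) : IsPartition (punion l (List.replicate n a)) := by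
  rw [punion_replicate hl.1]
  refine ⟨pairwise_filter_append hl.1 n a, fun x hx => ?_⟩
  simp only [List.mem_append, List.mem_replicate, List.mem_filter] at hx
  rcases hx with hx | hx | hx
  · exact hl.2 x hx.1
  · omega
  · exact hl.2 x hx.1

theorem part_punion_replicate {l : List ℕ} (hl : IsPartition l) (w h j : ℕ) :
    part (punion l (List.replicate w h)) j = insertCols w h (part l) j := by
  rw [punion_replicate hl.1]
  unfold insertCols
  have hL := filter_append_filter_not hl.1 h
  set A := l.filter (fun x => decide (h ≤ x)) with hA
  set B := l.filter (fun x => !decide (h ≤ x)) with hB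
  have hpA : ∀ i < A.length, h ≤ part A i := fun i hi => by
    have := part_mem hi
    rw [hA, List.mem_filter] at this
    simpa using this.2
  have hpB : ∀ i, part B i ≤ h := fun i => by
    rcases lt_or_ge i B.length with hi | hi
    · have := part_mem hi
      rw [hB, List.mem_filter] at this
      simp at this
      exact this.2.le
    · rw [part_eq_zero hi]
      omega
  have hpl : ∀ i, part l i = if i < A.length then part A i else part B (i - A.length) :=
    fun i => by rw [← part_append, hL]
  rw [part_append, part_append, part_replicate, List.length_replicate, hpl j, hpl (j - w)]
  have h1 := hpA j
  have h2 := hpA (j - w)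
  have h3 := hpB (j - A.length)
  have h4 := hpB (j - w - A.length)
  rw [show j - A.length - w = j - w - A.length by omega]
  have h5 := hl.part_antitone (show j - w ≤ j by omega)
  rw [hpl j, hpl (j - w)] at h5
  split_ifs at h5 ⊢ <;> omega

theorem isPartition_replicate (n : ℕ) {a : ℕ} (ha : 0 < a) :
    IsPartition (List.replicate n a) :=
  ⟨List.pairwise_replicate.2 (Or.inr le_rfl), fun x hx => by
    rw [List.eq_of_mem_replicate hx]; exact ha⟩

theorem KBounded.le {k : ℕ} {l : List ℕ} (h : KBounded k l) {x : ℕ} (hx : x ∈ l) : x ≤ k := by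
  obtain ⟨i, hi, rfl⟩ := List.getElem_of_mem hx
  have := h.1.part_antitone (Nat.zero_le i)
  rw [part, List.getD_eq_getElem _ _ hi] at this
  exact this.trans h.2

theorem colHeights_punion_kRectangle {k ℓ : ℕ} (hℓk : ℓ ≤ k) {l : List ℕ}
    (hl : l.Pairwise (· ≥ ·)) (hk : ∀ x ∈ l, x ≤ k) :
    colHeights k (punion l (List.replicate (k - ℓ + 1) ℓ)) =
      insertCols ℓ (k - ℓ + 1) (colHeights k l) := by
  rw [punion_replicate hl, colHeights, List.foldr_append, List.foldr_append,
    foldr_kRectangle hℓk (foldr_addRow_antitone (c := 0) antitone_const _)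
      (colHeights_add_eq_zero hℓk fun x hx => ?_),
    foldr_addRow_insertCols (foldr_addRow_antitone (c := 0) antitone_const _) fun x hx => ?_,
    ← List.foldr_append, filter_append_filter_not hl, colHeights]
  · rw [List.mem_filter] at hx
    exact ⟨by simpa using hx.2, hk x hx.1⟩
  · have := (List.mem_filter.1 hx).2
    simp at this
    exact this.le

theorem kConj_kRectangle {k ℓ : ℕ} (hℓ : 1 ≤ ℓ) (hℓk : ℓ ≤ k) :
    kConj k (List.replicate (k - ℓ + 1) ℓ) = List.replicate ℓ (k - ℓ + 1) := by
  obtain ⟨h1, h2⟩ := kConj_spec (k := k) (isPartition_replicate (k - ℓ + 1) hℓ) fun x hx => by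
    rw [List.eq_of_mem_replicate hx]
    exact hℓk
  refine h1.ext (isPartition_replicate _ (by omega)) fun j => ?_
  rw [h2, colHeights, foldr_kRectangle hℓk (c := 0) antitone_const fun _ _ => rfl, part_replicate]
  simp [insertCols]

/-- the `k`-conjugate distributes over union with a `k`-rectangle:
`(λ ∪ □)^{ω_k} = λ^{ω_k} ∪ □^{ω_k}`. -/
theorem kConj_union_kRectangle (k ℓ : ℕ) (hℓ : 1 ≤ ℓ) (hℓk : ℓ ≤ k) (lam : List ℕ)
    (hlam : KBounded k lam) :
    kConj k (punion lam (List.replicate (k - ℓ + 1) ℓ)) =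
      punion (kConj k lam) (kConj k (List.replicate (k - ℓ + 1) ℓ)) := by
  have hk : ∀ x ∈ lam, x ≤ k := fun x hx => hlam.le hx
  obtain ⟨h1, h2⟩ := kConj_spec hlam.1 hk
  obtain ⟨h3, h4⟩ := kConj_spec (k := k)
    (isPartition_punion_replicate hlam.1 (k - ℓ + 1) hℓ) fun x hx => by
      rw [punion, List.mem_mergeSort, List.mem_append] at hx
      rcases hx with hx | hx
      · exact hk x hx
      · rw [List.eq_of_mem_replicate hx]
        exact hℓk
  rw [kConj_kRectangle hℓ hℓk]
  refine h3.ext (isPartition_punion_replicate h1 _ (by omega)) fun j => ?_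
  rw [h4, part_punion_replicate h1, colHeights_punion_kRectangle hℓk hlam.1.1 hk, funext h2]
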